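/- arXiv:1802.00404 — 9 statements merged into one kernel-verified Lean document; each statement's English description precedes it below -/
import Mathlib

section
/- Let x* be a locally optimal solution of the problem (P). Then the penalty function F_λ = f + λφ is exact at x* if and only if λ̄(x*) < +∞. Moreover, if F_λ is exact at x*, then the least exact penalty parameter satisfies λ*(x*) = max{λ̄(x*), 0}. -/
open Filter Topology Set

/-- The linear penalty function `F_λ = f + λ φ`. -/
noncomputable def penaltyFun {X : Type*} (f : X → EReal) (φ : X → ℝ) (lam : ℝ) : X → EReal :=
  fun x => f x + ((lam * φ x : ℝ) : EReal)

/-- The penalty function `F_λ` is (locally) exact at `x`: for some `λ* ≥ 0`,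
`x` is a local minimizer of `F_{λ*}` on `A`. -/
def ExactPenaltyAt {X : Type*} [TopologicalSpace X] (f : X → EReal) (φ : X → ℝ)
    (A : Set X) (x : X) : Prop :=
  ∃ lam : ℝ, 0 ≤ lam ∧ IsLocalMinOn (penaltyFun f φ lam) A x

/-- The least exact penalty parameter `λ*(x)` of `F_λ` at `x`. -/
noncomputable def leastExactPenaltyParam {X : Type*} [TopologicalSpace X] (f : X → EReal)
    (φ : X → ℝ) (A : Set X) (x : X) : ℝ :=
  sInf {lam : ℝ | 0 ≤ lam ∧ IsLocalMinOn (penaltyFun f φ lam) A x}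

/-- `λ̄(x) = limsup_{y → x, y ∈ A \ M} (f(x) - f(y)) / (φ(y) - φ(x))`; the limit superior
over the trivial filter equals `⊥ = -∞`, which realizes the convention for the case when
`x` is not a limit point of `A \ M`. -/
noncomputable def lamBar {X : Type*} [TopologicalSpace X] (f : X → EReal) (φ : X → ℝ)
    (A M : Set X) (x : X) : EReal :=
  Filter.limsup (fun y => (f x - f y) / (((φ y - φ x : ℝ)) : EReal)) (𝓝[A \ M] x)

/-- Away from the feasible set, the penalty inequality is a bound on the difference quotient. -/
theorem penaltyFun_le_iff_div_le {X : Type*} {f : X → EReal} {φ : X → ℝ} {x y : X} {lam : ℝ}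
    (hx : φ x = 0) (hy : 0 < φ y) (hfy : f y ≠ ⊥) :
    penaltyFun f φ lam x ≤ penaltyFun f φ lam y ↔
      (f x - f y) / ((φ y - φ x : ℝ) : EReal) ≤ lam := by
  have hpos : (0 : EReal) < ((φ y : ℝ) : EReal) := by exact_mod_cast hy
  simp only [penaltyFun, hx, mul_zero, EReal.coe_zero, add_zero, sub_zero]
  rw [EReal.div_le_iff_le_mul hpos (EReal.coe_ne_top _),
    EReal.sub_le_iff_le_add (.inl hfy) (.inr (by rw [← EReal.coe_mul]; exact EReal.coe_ne_bot _)),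
    ← EReal.coe_mul, mul_comm (φ y), add_comm (f y)]

/-- A local minimizer of `f` on the feasible set locally minimizes `F_λ` on `A` iff the difference
quotients are eventually bounded by `λ`. -/
theorem isLocalMinOn_penaltyFun_iff {X : Type*} [TopologicalSpace X] {f : X → EReal} {φ : X → ℝ}
    {A : Set X} {x : X} (lam : ℝ) (hf : ∀ y, f y ≠ ⊥) (hφ : ∀ y, 0 ≤ φ y) (hx : φ x = 0)
    (hmin : IsLocalMinOn f ({y | φ y = 0} ∩ A) x) :
    IsLocalMinOn (penaltyFun f φ lam) A x ↔
      ∀ᶠ y in 𝓝[A \ {y | φ y = 0}] x, (f x - f y) / ((φ y - φ x : ℝ) : EReal) ≤ lam := by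
  have hfeas : ∀ᶠ y in 𝓝[{y | φ y = 0} ∩ A] x, penaltyFun f φ lam x ≤ penaltyFun f φ lam y := by
    filter_upwards [hmin, self_mem_nhdsWithin] with y hy hyM
    simpa [penaltyFun, hx, show φ y = 0 from hyM.1] using hy
  have hsplit : 𝓝[A] x = 𝓝[A \ {y | φ y = 0}] x ⊔ 𝓝[{y | φ y = 0} ∩ A] x := by
    rw [← nhdsWithin_union, inter_comm, sdiff_union_inter]
  rw [IsLocalMinOn, IsMinFilter, hsplit, eventually_sup, and_iff_left hfeas]
  refine eventually_congr ?_
  filter_upwards [self_mem_nhdsWithin] with y hy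
  exact penaltyFun_le_iff_div_le hx (lt_of_le_of_ne (hφ y) (Ne.symm hy.2)) (hf y)

/-- The upper limit is less than `⊤` iff there is an eventual nonnegative real upper bound. -/
theorem exists_nonneg_eventually_le_iff_limsup_lt_top {α : Type*} {l : Filter α} {q : α → EReal} :
    (∃ r : ℝ, 0 ≤ r ∧ ∀ᶠ y in l, q y ≤ r) ↔ limsup q l < ⊤ := by
  constructor
  · rintro ⟨r, -, hr⟩
    exact (limsup_le_of_le (h := hr)).trans_lt (EReal.coe_lt_top r)
  · intro h
    obtain ⟨r, hr, -⟩ := EReal.lt_iff_exists_real_btwn.1 h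
    refine ⟨max r 0, le_max_right _ _, ?_⟩
    filter_upwards [eventually_lt_of_limsup_lt hr] with y hy
    exact hy.le.trans (EReal.coe_le_coe_iff.2 (le_max_left _ _))

/-- The infimum of the eventual nonnegative real upper bounds is the nonnegative part of the
upper limit. -/
theorem coe_sInf_nonneg_eventually_le {α : Type*} {l : Filter α} {q : α → EReal}
    (h : limsup q l < ⊤) :
    ((sInf {r : ℝ | 0 ≤ r ∧ ∀ᶠ y in l, q y ≤ r} : ℝ) : EReal) = max (limsup q l) 0 := by
  have hbdd : BddBelow {r : ℝ | 0 ≤ r ∧ ∀ᶠ y in l, q y ≤ r} := ⟨0, fun r hr => hr.1⟩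
  have htop : max (limsup q l) 0 ≠ ⊤ := (max_lt h EReal.zero_lt_top).ne
  have hbot : max (limsup q l) 0 ≠ ⊥ := (EReal.bot_lt_zero.trans_le (le_max_right _ _)).ne'
  apply le_antisymm
  · refine EReal.le_of_forall_lt_iff_le.1 fun t ht => EReal.coe_le_coe_iff.2 (csInf_le hbdd ?_)
    obtain ⟨hlim, hpos⟩ := max_lt_iff.1 ht
    exact ⟨(EReal.coe_pos.1 hpos).le,
      (eventually_lt_of_limsup_lt hlim).mono fun _ hy => hy.le⟩
  · rw [← EReal.coe_toReal htop hbot, EReal.coe_le_coe_iff]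
    refine le_csInf (exists_nonneg_eventually_le_iff_limsup_lt_top.2 h) fun r hr => ?_
    rw [← EReal.coe_le_coe_iff, EReal.coe_toReal htop hbot]
    exact max_le (limsup_le_of_le (h := hr.2)) (EReal.coe_nonneg.2 hr.1)

/-- Theorem: a penalty function is exact at a locally optimal solution `x*` of the problem
`(𝒫)` iff `λ̄(x*) < +∞`, in which case `λ*(x*) = max{λ̄(x*), 0}`. -/
theorem exactPenaltyAt_iff_lamBar_lt_top {X : Type*} [TopologicalSpace X]
    (f : X → EReal) (φ : X → ℝ) (A M : Set X)
    (hAne : A.Nonempty) (hMne : M.Nonempty)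
    (hfbot : ∀ x, f x ≠ ⊥) (hφnn : ∀ x, 0 ≤ φ x) (hMdef : M = {x | φ x = 0})
    (hproper : ∃ x ∈ M ∩ A, f x ≠ ⊤)
    (xs : X) (hxs : xs ∈ M ∩ A) (hfin : f xs ≠ ⊤)
    (hlocopt : IsLocalMinOn f (M ∩ A) xs) :
    (ExactPenaltyAt f φ A xs ↔ lamBar f φ A M xs < ⊤) ∧
    (ExactPenaltyAt f φ A xs →
      (leastExactPenaltyParam f φ A xs : EReal) = max (lamBar f φ A M xs) 0) := by
  subst hMdef
  have hiff (lam : ℝ) := isLocalMinOn_penaltyFun_iff lam hfbot hφnn hxs.1 hlocopt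
  have hexact : ExactPenaltyAt f φ A xs ↔ lamBar f φ A {x | φ x = 0} xs < ⊤ := by
    simp only [ExactPenaltyAt, hiff]
    exact exists_nonneg_eventually_le_iff_limsup_lt_top
  refine ⟨hexact, fun h => ?_⟩
  simp only [leastExactPenaltyParam, hiff]
  exact coe_sInf_nonneg_eventually_le (hexact.1 h)
end

section
/- Let x* be a locally optimal solution of the problem (P). Suppose there exist r > 0 and functions ω, η : [0,∞) → [0,∞) such that: (1) ω(0) = 0, η(0) = 0 and η(t) > 0 for all t > 0; (2) f(y) ≥ f(x*) − ω(d(y, Ω)) for all y ∈ B(x*, r) ∩ (A∖M); (3) φ(x) ≥ η(d(x, Ω)) for all x ∈ B(x*, r) ∩ A; (4) σ := limsup_{t → 0+} ω(t)/η(t) < +∞. Then the penalty function F_λ is exact at x* and λ*(x*) ≤ σ. -/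
open Filter Topology Set

/-- Under the error bound hypotheses, `x*` is a local minimizer of `F_λ` on `A` as soon as
`ω ≤ λ η` holds near zero on the positive half-line. -/
theorem isLocalMinOn_penaltyFun_of_errorBound {X : Type*} [MetricSpace X]
    {f : X → EReal} {φ : X → ℝ} {A M : Set X}
    (hφnn : ∀ x, 0 ≤ φ x) (hM : ∀ x ∈ M, φ x = 0)
    {xs : X} (hxs : xs ∈ M ∩ A) (hlocopt : IsLocalMinOn f (M ∩ A) xs)
    {r : ℝ} (hr : 0 < r) {ω η : ℝ → ℝ} (hω0 : ω 0 = 0)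
    (hfest : ∀ y ∈ Metric.closedBall xs r ∩ (A \ M),
      f xs - ((ω (Metric.infDist y (M ∩ A)) : ℝ) : EReal) ≤ f y)
    (hφest : ∀ x ∈ Metric.closedBall xs r ∩ A, η (Metric.infDist x (M ∩ A)) ≤ φ x)
    {lam : ℝ} (hlam : 0 ≤ lam) (hle : ∀ᶠ t in 𝓝[Set.Ioi (0 : ℝ)] 0, ω t ≤ lam * η t) :
    IsLocalMinOn (penaltyFun f φ lam) A xs := by
  obtain ⟨δ, hδ, hδle⟩ := Metric.mem_nhdsWithin_iff.1 hle
  obtain ⟨ε, hε, hεle⟩ := Metric.mem_nhdsWithin_iff.1 hlocopt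
  refine Metric.mem_nhdsWithin_iff.2 ⟨min r (min δ ε), by positivity, ?_⟩
  rintro y ⟨hy, hyA⟩
  simp only [Metric.mem_ball, lt_min_iff] at hy
  obtain ⟨hyr, hyδ, hyε⟩ := hy
  have hyB : y ∈ Metric.closedBall xs r := Metric.mem_closedBall.2 hyr.le
  simp only [penaltyFun, hM xs hxs.1, mul_zero, EReal.coe_zero, add_zero]
  by_cases hyM : y ∈ M
  · simpa [hM y hyM] using hεle ⟨hyε, hyM, hyA⟩
  have hω : ω (Metric.infDist y (M ∩ A)) ≤ lam * φ y := by
    rcases (Metric.infDist_nonneg (x := y) (s := M ∩ A)).eq_or_lt' with h0 | hpos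
    · rw [h0, hω0]
      exact mul_nonneg hlam (hφnn y)
    · have hdist : dist (Metric.infDist y (M ∩ A)) 0 < δ := by
        rw [Real.dist_0_eq_abs, abs_of_pos hpos]
        exact (Metric.infDist_le_dist_of_mem hxs).trans_lt hyδ
      exact (hδle ⟨hdist, hpos⟩ : _ ≤ _).trans
        (mul_le_mul_of_nonneg_left (hφest y ⟨hyB, hyA⟩) hlam)
  calc f xs ≤ f y + ((ω (Metric.infDist y (M ∩ A)) : ℝ) : EReal) :=
        EReal.sub_le_iff_le_add (by simp) (by simp) |>.1 (hfest y ⟨hyB, hyA, hyM⟩)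
    _ ≤ f y + ((lam * φ y : ℝ) : EReal) := by gcongr

/-- Theorem: error bounds yield local exactness of the penalty function, with the upper
estimate `λ*(x*) ≤ σ = limsup_{t → 0+} ω(t)/η(t)` for the least exact penalty parameter. -/
theorem exactPenaltyAt_of_errorBound {X : Type*} [MetricSpace X]
    (f : X → EReal) (φ : X → ℝ) (A M : Set X)
    (hAne : A.Nonempty) (hMne : M.Nonempty)
    (hfbot : ∀ x, f x ≠ ⊥) (hφnn : ∀ x, 0 ≤ φ x) (hMdef : M = {x | φ x = 0})
    (hproper : ∃ x ∈ M ∩ A, f x ≠ ⊤)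
    (xs : X) (hxs : xs ∈ M ∩ A) (hfin : f xs ≠ ⊤)
    (hlocopt : IsLocalMinOn f (M ∩ A) xs)
    (r : ℝ) (hr : 0 < r) (ω η : ℝ → ℝ)
    (hωnn : ∀ t, 0 ≤ ω t) (hηnn : ∀ t, 0 ≤ η t)
    (hω0 : ω 0 = 0) (hη0 : η 0 = 0) (hηpos : ∀ t, 0 < t → 0 < η t)
    (hfest : ∀ y ∈ Metric.closedBall xs r ∩ (A \ M),
      f xs - ((ω (Metric.infDist y (M ∩ A)) : ℝ) : EReal) ≤ f y)
    (hφest : ∀ x ∈ Metric.closedBall xs r ∩ A, η (Metric.infDist x (M ∩ A)) ≤ φ x)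
    (σ : EReal)
    (hσdef : σ = Filter.limsup (fun t => ((ω t / η t : ℝ) : EReal)) (𝓝[Set.Ioi (0:ℝ)] 0))
    (hσ : σ < ⊤) :
    ExactPenaltyAt f φ A xs ∧ (leastExactPenaltyParam f φ A xs : EReal) ≤ σ := by
  have hσ0 : 0 ≤ σ := by
    rw [hσdef]
    refine le_limsup_of_frequently_le' (Eventually.frequently (Eventually.of_forall fun t => ?_))
    exact_mod_cast div_nonneg (hωnn t) (hηnn t)
  have key : ∀ lam : ℝ, σ < lam → 0 ≤ lam ∧ IsLocalMinOn (penaltyFun f φ lam) A xs := by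
    intro lam hlt
    have hlam : 0 ≤ lam := by exact_mod_cast hσ0.trans hlt.le
    refine ⟨hlam, isLocalMinOn_penaltyFun_of_errorBound hφnn (fun x hx => by
      simpa [hMdef] using hx) hxs hlocopt hr hω0 hfest hφest hlam ?_⟩
    rw [hσdef] at hlt
    filter_upwards [eventually_lt_of_limsup_lt hlt, self_mem_nhdsWithin] with t ht htpos
    exact ((div_lt_iff₀ (hηpos t htpos)).1 (by exact_mod_cast ht)).le
  constructor
  · obtain ⟨lam, hlt, -⟩ := EReal.lt_iff_exists_real_btwn.1 hσ
    exact ⟨lam, key lam hlt⟩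
  · refine le_of_forall_gt_imp_ge_of_dense fun c hc => ?_
    obtain ⟨lam, hlt, hlc⟩ := EReal.lt_iff_exists_real_btwn.1 hc
    refine le_trans ?_ hlc.le
    exact EReal.coe_le_coe_iff.2 (csInf_le ⟨0, fun _ h => h.1⟩ (key lam hlt))
end

section
/- Let x* ∈ Ω and let ω : [0,∞) → [0,∞) be a function with ω(0) = 0. Suppose that for every function f : X → ℝ ∪ {+∞} satisfying (1) x* is a point of local minimum of f on Ω, and (2) there exists r > 0 with f(y) ≥ f(x*) − ω(d(y, Ω)) for all y ∈ B(x*, r) ∩ (A∖M), the penalty function F_λ = f + λφ is exact at x*. Then there exist a > 0 and r > 0 such that φ(x) ≥ a ω(d(x, Ω)) for all x ∈ B(x*, r) ∩ A. -/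
open Filter Topology Set

/-- Theorem: if the penalty function `F_λ = f + λφ` is exact at `x* ∈ Ω` for every
objective function `f` having `x*` as a local minimizer on `Ω = M ∩ A` and satisfying the
lower estimate `f(y) ≥ f(x*) - ω(d(y, Ω))` near `x*` on `A \ M`, then the penalty term
satisfies a local lower error bound `φ(x) ≥ a ω(d(x, Ω))`. -/
theorem penaltyTerm_lower_estimate_of_exactness {X : Type*} [MetricSpace X]
    (φ : X → ℝ) (A M : Set X)
    (hAne : A.Nonempty) (hMne : M.Nonempty)
    (hφnn : ∀ x, 0 ≤ φ x) (hMdef : M = {x | φ x = 0})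
    (xs : X) (hxs : xs ∈ M ∩ A)
    (ω : ℝ → ℝ) (hωnn : ∀ t, 0 ≤ ω t) (hω0 : ω 0 = 0)
    (hexact : ∀ f : X → EReal, (∀ x, f x ≠ ⊥) → f xs ≠ ⊤ →
      IsLocalMinOn f (M ∩ A) xs →
      (∃ r : ℝ, 0 < r ∧ ∀ y ∈ Metric.closedBall xs r ∩ (A \ M),
        f xs - ((ω (Metric.infDist y (M ∩ A)) : ℝ) : EReal) ≤ f y) →
      ExactPenaltyAt f φ A xs) :
    ∃ a : ℝ, 0 < a ∧ ∃ r : ℝ, 0 < r ∧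
      ∀ x ∈ Metric.closedBall xs r ∩ A, a * ω (Metric.infDist x (M ∩ A)) ≤ φ x := by
  have hφxs : φ xs = 0 := by simpa [hMdef] using hxs.1
  have hωΩ : ∀ x ∈ M ∩ A, ω (Metric.infDist x (M ∩ A)) = 0 := fun x hx => by
    rw [Metric.infDist_zero_of_mem hx, hω0]
  -- Test exactness on the extremal objective `-ω(d(·, Ω))`.
  obtain ⟨lam, hlam, hmin⟩ := hexact
    (fun x => ((-ω (Metric.infDist x (M ∩ A)) : ℝ) : EReal))
    (fun x => EReal.coe_ne_bot _) (EReal.coe_ne_top _)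
    (by
      filter_upwards [self_mem_nhdsWithin] with x hx
      rw [hωΩ x hx, hωΩ xs hxs])
    ⟨1, one_pos, fun y _ => by
      rw [hωΩ xs hxs, ← EReal.coe_sub, neg_zero, zero_sub]⟩
  obtain ⟨r, hr, hball⟩ :=
    (Metric.nhds_basis_closedBall.eventually_iff).1 (eventually_nhdsWithin_iff.1 hmin)
  refine ⟨(lam + 1)⁻¹, by positivity, r, hr, fun x hx => ?_⟩
  have hle := hball hx.1 hx.2
  simp only [penaltyFun, ← EReal.coe_add, EReal.coe_le_coe_iff] at hle
  rw [hωΩ xs hxs, hφxs] at hle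
  rw [inv_mul_le_iff₀ (by positivity)]
  linarith [hφnn x]
end

section
/- Let x* be a locally optimal solution of the problem (P). Suppose there exist r > 0 and a function ω : [0,∞) → [0,∞), continuous from the right, such that f(x) − f(y) ≤ ω(d(x, y)) for all x ∈ B(x*, r) ∩ Ω and all y ∈ B(x*, r) ∩ (A∖M). Then there exists δ > 0 such that f(y) ≥ f(x*) − ω(d(y, Ω)) for all y ∈ B(x*, δ) ∩ (A∖M). -/
open Filter Topology Set

/-- Theorem: a uniform modulus-of-continuity estimate between feasible and infeasible points
near a locally optimal solution `x*` yields the lower estimate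
`f(y) ≥ f(x*) - ω(d(y, Ω))` near `x*` on `A \ M`. -/
theorem lower_estimate_of_modulus {X : Type*} [MetricSpace X]
    (f : X → EReal) (φ : X → ℝ) (A M : Set X)
    (hAne : A.Nonempty) (hMne : M.Nonempty)
    (hfbot : ∀ x, f x ≠ ⊥) (hφnn : ∀ x, 0 ≤ φ x) (hMdef : M = {x | φ x = 0})
    (hproper : ∃ x ∈ M ∩ A, f x ≠ ⊤)
    (xs : X) (hxs : xs ∈ M ∩ A) (hfin : f xs ≠ ⊤)
    (hlocopt : IsLocalMinOn f (M ∩ A) xs)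
    (r : ℝ) (hr : 0 < r) (ω : ℝ → ℝ) (hωnn : ∀ t, 0 ≤ ω t)
    (hωrc : ∀ t, 0 ≤ t → ContinuousWithinAt ω (Set.Ici t) t)
    (hmod : ∀ x ∈ Metric.closedBall xs r ∩ (M ∩ A),
      ∀ y ∈ Metric.closedBall xs r ∩ (A \ M),
        f x - f y ≤ ((ω (dist x y) : ℝ) : EReal)) :
    ∃ δ : ℝ, 0 < δ ∧ ∀ y ∈ Metric.closedBall xs δ ∩ (A \ M),
      f xs - ((ω (Metric.infDist y (M ∩ A)) : ℝ) : EReal) ≤ f y := by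
  obtain ⟨ε, hε, hmin⟩ := Metric.mem_nhdsWithin_iff.mp hlocopt
  obtain ⟨δ, hδ, hδε, hδr⟩ : ∃ δ : ℝ, 0 < δ ∧ 3 * δ ≤ ε ∧ 3 * δ ≤ r :=
    ⟨min ε r / 3, by positivity, by linarith [min_le_left ε r], by linarith [min_le_right ε r]⟩
  refine ⟨δ, hδ, ?_⟩
  rintro y ⟨hyδ, hyAM⟩
  rw [Metric.mem_closedBall] at hyδ
  have hyr : y ∈ Metric.closedBall xs r := Metric.mem_closedBall.mpr (by linarith)
  by_cases hytop : f y = ⊤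
  · simp [hytop]
  have hD : Metric.infDist y (M ∩ A) ≤ dist y xs := Metric.infDist_le_dist_of_mem hxs
  set D := Metric.infDist y (M ∩ A)
  obtain ⟨a, ha⟩ : ∃ a : ℝ, (a : EReal) = f xs := ⟨_, EReal.coe_toReal hfin (hfbot xs)⟩
  obtain ⟨b, hb⟩ : ∃ b : ℝ, (b : EReal) = f y := ⟨_, EReal.coe_toReal hytop (hfbot y)⟩
  suffices h : a - b ≤ ω D by
    rw [← ha, ← hb, ← EReal.coe_sub, EReal.coe_le_coe_iff]
    linarith
  by_contra! hlt
  obtain ⟨ρ, hρ, hball⟩ := Metric.mem_nhdsWithin_iff.mp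
    ((hωrc D Metric.infDist_nonneg).eventually (gt_mem_nhds hlt))
  obtain ⟨x, hx, hxy⟩ := (Metric.infDist_lt_iff ⟨xs, hxs⟩).mp
    (show Metric.infDist y (M ∩ A) < D + min ρ δ from lt_add_of_pos_right _ (lt_min hρ hδ))
  have hDx : D ≤ dist y x := Metric.infDist_le_dist_of_mem hx
  have hxρ : dist y x < D + ρ := hxy.trans_le (by gcongr; exact min_le_left _ _)
  have hxδ : dist y x < D + δ := hxy.trans_le (by gcongr; exact min_le_right _ _)
  have hxxs : dist x xs < 3 * δ := by
    linarith [dist_triangle_left x xs y]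
  have hfx : f xs ≤ f x := hmin ⟨Metric.mem_ball.mpr (by linarith), hx⟩
  have hωx : ω (dist y x) < a - b := by
    refine hball ⟨?_, hDx⟩
    rw [Metric.mem_ball, Real.dist_eq, abs_lt]
    constructor <;> linarith
  have hle : f xs - f y ≤ ((ω (dist x y) : ℝ) : EReal) :=
    (EReal.sub_le_sub hfx le_rfl).trans
      (hmod x ⟨Metric.mem_closedBall.mpr (by linarith), hx⟩ y ⟨hyr, hyAM⟩)
  rw [← ha, ← hb, ← EReal.coe_sub, EReal.coe_le_coe_iff, dist_comm] at hle
  exact hle.not_gt hωx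
end

section
/- Let x* be a locally optimal solution of the problem (P) and let α ∈ (0, 1]. Then the penalty function F_λ = f + λφ is exact at x* for every function f that is Hölder continuous with exponent α in a neighbourhood of x* (and has x* as a local minimizer on Ω) if and only if there exist r > 0 and a > 0 such that φ(x) ≥ a (d(x, Ω))^α for all x ∈ B(x*, r) ∩ A. -/
open Filter Topology Set

/-- The penalty function `F_λ = f + λφ` (real-valued objective) is (locally) exact at `x`. -/
def ExactPenaltyAtR {X : Type*} [TopologicalSpace X] (f : X → ℝ) (φ : X → ℝ)
    (A : Set X) (x : X) : Prop :=
  ∃ lam : ℝ, 0 ≤ lam ∧ IsLocalMinOn (fun y => f y + lam * φ y) A x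

/-- Subadditivity of `t ↦ t ^ α` for `α ∈ [0, 1]`, as a Hölder estimate. -/
lemma abs_rpow_sub_rpow_le_of_abs_sub_le {u v w α : ℝ} (hu : 0 ≤ u) (hv : 0 ≤ v)
    (huv : |u - v| ≤ w) (hα0 : 0 ≤ α) (hα1 : α ≤ 1) :
    |u ^ α - v ^ α| ≤ w ^ α := by
  have hw : 0 ≤ w := (abs_nonneg _).trans huv
  have key : ∀ s t : ℝ, 0 ≤ s → 0 ≤ t → s ≤ t + w → s ^ α ≤ t ^ α + w ^ α :=
    fun s t hs ht hst =>
      (Real.rpow_le_rpow hs hst hα0).trans (Real.rpow_add_le_add_rpow ht hw hα0 hα1)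
  obtain ⟨h₁, h₂⟩ := abs_le.1 huv
  rw [abs_le]
  constructor
  · linarith [key v u hv hu (by linarith)]
  · linarith [key u v hu hv (by linarith)]

lemma abs_infDist_sub_infDist_le_dist {X : Type*} [PseudoMetricSpace X] (s : Set X) (x y : X) :
    |Metric.infDist x s - Metric.infDist y s| ≤ dist x y := by
  have h₁ := Metric.infDist_le_infDist_add_dist (s := s) (x := x) (y := y)
  have h₂ := Metric.infDist_le_infDist_add_dist (s := s) (x := y) (y := x)
  rw [dist_comm y x] at h₂
  rw [abs_le]
  constructor <;> linarith

/-- A Hölder function decreases below its local minimum over `Ω` at most at the rate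
`infDist x Ω ^ α`. -/
lemma eventually_sub_le_mul_infDist_rpow {X : Type*} [PseudoMetricSpace X] {f : X → ℝ}
    {Ω U : Set X} {xs : X} {C α : ℝ} (hxs : xs ∈ Ω) (hU : U ∈ 𝓝 xs) (hC : 0 ≤ C) (hα : 0 ≤ α)
    (hf : ∀ x ∈ U, ∀ y ∈ U, |f x - f y| ≤ C * dist x y ^ α) (hmin : IsLocalMinOn f Ω xs) :
    ∀ᶠ x in 𝓝 xs, f xs - f x ≤ C * Metric.infDist x Ω ^ α := by
  have hmin' : ∀ᶠ y in 𝓝 xs, y ∈ Ω → f xs ≤ f y := eventually_nhdsWithin_iff.1 hmin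
  obtain ⟨ρ, hρ, hball⟩ := Metric.eventually_nhds_iff.1 (hmin'.and hU)
  refine Metric.eventually_nhds_iff.2 ⟨ρ / 2, half_pos hρ, fun x hx => ?_⟩
  have hlt : Metric.infDist x Ω < ρ / 2 := (Metric.infDist_le_dist_of_mem hxs).trans_lt hx
  have hlim : Tendsto (fun t : ℝ => C * t ^ α) (𝓝[>] Metric.infDist x Ω)
      (𝓝 (C * Metric.infDist x Ω ^ α)) :=
    ((Real.continuousAt_rpow_const _ _ (Or.inr hα)).const_mul C).tendsto.mono_left
      nhdsWithin_le_nhds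
  refine ge_of_tendsto hlim ?_
  filter_upwards [Ioo_mem_nhdsGT hlt] with t ht
  obtain ⟨y, hyΩ, hy⟩ := (Metric.infDist_lt_iff ⟨xs, hxs⟩).1 ht.1
  have hyxs : dist y xs < ρ := by
    have h := dist_triangle_left y xs x
    linarith [ht.2]
  have hyball := hball hyxs
  have hxball := hball (hx.trans (half_lt_self hρ))
  have hxy := (abs_le.1 (hf x hxball.2 y hyball.2)).1
  have hpow : C * dist x y ^ α ≤ C * t ^ α :=
    mul_le_mul_of_nonneg_left (Real.rpow_le_rpow dist_nonneg hy.le hα) hC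
  linarith [hyball.1 hyΩ]

/-- Theorem: the penalty function `F_λ = f + λφ` is exact at `x* ∈ Ω` for every function `f`
that is Hölder continuous with exponent `α ∈ (0, 1]` near `x*` (and has `x*` as a local
minimizer on `Ω`) if and only if `φ(x) ≥ a d(x, Ω)^α` holds for some `a > 0` on a ball
around `x*` intersected with `A`. -/
theorem exact_for_all_holder_iff_penaltyTerm_bound {X : Type*} [MetricSpace X]
    (φ : X → ℝ) (A M : Set X)
    (hAne : A.Nonempty) (hMne : M.Nonempty)
    (hφnn : ∀ x, 0 ≤ φ x) (hMdef : M = {x | φ x = 0})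
    (xs : X) (hxs : xs ∈ M ∩ A)
    (α : ℝ) (hα0 : 0 < α) (hα1 : α ≤ 1) :
    (∀ f : X → ℝ,
      (∃ U ∈ 𝓝 xs, ∃ C : ℝ, 0 < C ∧
        ∀ x ∈ U, ∀ y ∈ U, |f x - f y| ≤ C * dist x y ^ α) →
      IsLocalMinOn f (M ∩ A) xs →
      ExactPenaltyAtR f φ A xs) ↔
    (∃ r : ℝ, 0 < r ∧ ∃ a : ℝ, 0 < a ∧
      ∀ x ∈ Metric.closedBall xs r ∩ A, a * Metric.infDist x (M ∩ A) ^ α ≤ φ x) := by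
  have hφxs : φ xs = 0 := by
    have h := hxs.1
    rwa [hMdef] at h
  have hxs0 : Metric.infDist xs (M ∩ A) = 0 := Metric.infDist_zero_of_mem hxs
  constructor
  · intro h
    obtain ⟨lam, hlam, hmin⟩ := h (fun x => -Metric.infDist x (M ∩ A) ^ α)
      ⟨univ, univ_mem, 1, one_pos, fun x _ y _ => by
        rw [one_mul, neg_sub_neg, abs_sub_comm]
        exact abs_rpow_sub_rpow_le_of_abs_sub_le Metric.infDist_nonneg Metric.infDist_nonneg
          (abs_infDist_sub_infDist_le_dist _ x y) hα0.le hα1⟩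
      (eventually_nhdsWithin_of_forall fun y hy => by
        simp only [hxs0, Metric.infDist_zero_of_mem hy, le_refl])
    obtain ⟨r, hr, hball⟩ :=
      Metric.nhds_basis_closedBall.eventually_iff.1 (eventually_nhdsWithin_iff.1 hmin)
    refine ⟨r, hr, (lam + 1)⁻¹, by positivity, fun x hx => ?_⟩
    have hx' := hball hx.1 hx.2
    simp only [hxs0, hφxs, Real.zero_rpow hα0.ne', neg_zero, mul_zero, add_zero] at hx'
    rw [inv_mul_le_iff₀ (by positivity)]
    linarith [hφnn x]
  · rintro ⟨r, hr, a, ha, hbound⟩ f ⟨U, hU, C, hC, hf⟩ hmin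
    refine ⟨C / a, by positivity, eventually_nhdsWithin_iff.2 ?_⟩
    filter_upwards [eventually_sub_le_mul_infDist_rpow hxs hU hC.le hα0.le hf hmin,
      Metric.closedBall_mem_nhds xs hr] with x hx hxr hxA
    have h : C / a * (a * Metric.infDist x (M ∩ A) ^ α) ≤ C / a * φ x :=
      mul_le_mul_of_nonneg_left (hbound x ⟨hxr, hxA⟩) (by positivity)
    rw [← mul_assoc, div_mul_cancel₀ C ha.ne'] at h
    simp only [hφxs, mul_zero, add_zero]
    linarith
end

section
/- Let x* be a locally optimal solution of the problem (P), and let ω : [0,∞) → [0,∞) be strictly increasing, continuous from the right, with ω(0) = 0. Suppose f is lower semicontinuous at x*. Then the problem (P_{p*}) is ω-calm at x* (with some constant a > 0) if and only if there exist a > 0 and a neighbourhood U of x* such that f(x) ≥ f(x*) − a ω(d_P(p*, Ω⁻¹(x))) for all x ∈ U. -/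
open Filter Topology Set

/-- Theorem: for a strictly increasing, right-continuous `ω` with `ω(0) = 0` and `f` lower
semicontinuous at a locally optimal solution `x*`, the perturbed problem `(𝒫_{p*})` is
`ω`-calm at `x*` (with some constant `a > 0`) iff for some `a > 0` the estimate
`f(x) ≥ f(x*) - a ω(d_P(p*, Ω⁻¹(x)))` holds on a neighbourhood of `x*`.  Here
`Ω(p) = M̂(p) ∩ A`, `Ω⁻¹(x) = {p | x ∈ Ω(p)}`, and the convention `ω(+∞) = +∞`
(so the estimate holds trivially when `Ω⁻¹(x) = ∅`) is realized by only requiring the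
estimate when `EMetric.infEdist p* (Ω⁻¹ x) ≠ ⊤`. -/
theorem calm_iff_lower_estimate_via_inverse_image {X : Type*} [TopologicalSpace X]
    {Pa : Type*} [MetricSpace Pa]
    (f : X → EReal) (φ : X → ℝ) (A M : Set X)
    (Mhat : Pa → Set X) (pstar : Pa) (hMp : Mhat pstar = M)
    (hAne : A.Nonempty) (hMne : M.Nonempty)
    (hfbot : ∀ x, f x ≠ ⊥) (hφnn : ∀ x, 0 ≤ φ x) (hMdef : M = {x | φ x = 0})
    (hproper : ∃ x ∈ M ∩ A, f x ≠ ⊤)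
    (xs : X) (hxs : xs ∈ M ∩ A) (hfin : f xs ≠ ⊤)
    (hlocopt : IsLocalMinOn f (M ∩ A) xs)
    (ω : ℝ → ℝ) (hωnn : ∀ t, 0 ≤ ω t) (hω0 : ω 0 = 0)
    (hωmono : StrictMonoOn ω (Set.Ici 0))
    (hωrc : ∀ t, 0 ≤ t → ContinuousWithinAt ω (Set.Ici t) t)
    (hlsc : LowerSemicontinuousAt f xs) :
    (∃ a : ℝ, 0 < a ∧ ∃ r : ℝ, 0 < r ∧ ∃ U ∈ 𝓝 xs, ∀ p ∈ Metric.closedBall pstar r,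
      ∀ x ∈ U ∩ (Mhat p ∩ A),
        f xs - ((a * ω (dist p pstar) : ℝ) : EReal) ≤ f x) ↔
    (∃ a : ℝ, 0 < a ∧ ∃ U ∈ 𝓝 xs, ∀ x ∈ U,
      EMetric.infEdist pstar {p | x ∈ Mhat p ∩ A} ≠ ⊤ →
        f xs - ((a * ω ((EMetric.infEdist pstar {p | x ∈ Mhat p ∩ A}).toReal) : ℝ) : EReal)
          ≤ f x) := by
  have hcoe : f xs = ((f xs).toReal : EReal) := (EReal.coe_toReal hfin (hfbot xs)).symm
  generalize (f xs).toReal = c at hcoe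
  rw [hcoe]
  constructor
  · rintro ⟨a, ha, r, hr, U, hU, h⟩
    have hωr : 0 < ω r := hω0 ▸ hωmono (mem_Ici.2 le_rfl) (mem_Ici.2 hr.le) hr
    have hV : ∀ᶠ x in 𝓝 xs, ((c - a * ω r : ℝ) : EReal) < f x := by
      apply hlsc
      rw [hcoe]
      exact EReal.coe_lt_coe_iff.2 (by nlinarith [mul_pos ha hωr])
    refine ⟨a, ha, U ∩ {x | ((c - a * ω r : ℝ) : EReal) < f x}, inter_mem hU hV, ?_⟩
    rintro x ⟨hxU, hxV⟩ hne
    rw [← EReal.coe_sub]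
    set S := {p | x ∈ Mhat p ∩ A}
    change Metric.infEDist pstar S ≠ ⊤ at hne
    obtain ⟨d, hd⟩ : ∃ d, d = (Metric.infEDist pstar S).toReal := ⟨_, rfl⟩
    have hd0 : 0 ≤ d := hd ▸ ENNReal.toReal_nonneg
    change ((c - a * ω (Metric.infEDist pstar S).toReal : ℝ) : EReal) ≤ f x
    rw [← hd]
    rcases le_or_gt r d with hrd | hdr
    · refine le_trans (EReal.coe_le_coe_iff.2 ?_) (le_of_lt hxV)
      have := hωmono.monotoneOn (mem_Ici.2 hr.le) (mem_Ici.2 hd0) hrd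
      nlinarith [mul_le_mul_of_nonneg_left this ha.le]
    · by_contra! hlt
      have hftop : f x ≠ ⊤ := ne_top_of_lt hlt
      have hy : f x = ((f x).toReal : EReal) := (EReal.coe_toReal hftop (hfbot x)).symm
      generalize (f x).toReal = y at hy
      rw [hy, EReal.coe_lt_coe_iff] at hlt
      have hlt' : ω d < (c - y) / a := by
        rw [lt_div_iff₀ ha]; linarith
      have hev : ∀ᶠ t in 𝓝[≥] d, ω t < (c - y) / a :=
        (hωrc d hd0).eventually_lt_const hlt'
      obtain ⟨u, hu, hsub⟩ := (mem_nhdsGE_iff_exists_Ico_subset).1 hev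
      have hdlt : Metric.infEDist pstar S < ENNReal.ofReal (min u r) := by
        rw [← ENNReal.ofReal_toReal hne, ← hd,
          ENNReal.ofReal_lt_ofReal_iff (lt_min (hd0.trans_lt hu) hr)]
        exact lt_min hu hdr
      obtain ⟨p, hp, hpd⟩ := Metric.infEDist_lt_iff.1 hdlt
      have hle : d ≤ dist p pstar := by
        rw [hd, dist_comm, dist_edist]
        exact ENNReal.toReal_mono (edist_ne_top _ _) (Metric.infEDist_le_edist_of_mem hp)
      rw [edist_dist, ENNReal.ofReal_lt_ofReal_iff (lt_min (hd0.trans_lt hu) hr),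
        dist_comm, lt_min_iff] at hpd
      have h1 : ω (dist p pstar) < (c - y) / a := hsub ⟨hle, hpd.1⟩
      have h2 := h p (Metric.mem_closedBall.2 hpd.2.le) x ⟨hxU, hp⟩
      rw [hy, ← EReal.coe_sub, EReal.coe_le_coe_iff] at h2
      rw [lt_div_iff₀ ha] at h1
      linarith
  · rintro ⟨a, ha, U, hU, h⟩
    refine ⟨a, ha, 1, one_pos, U, hU, ?_⟩
    rintro p - x ⟨hxU, hxp⟩
    have hle : Metric.infEDist pstar {p | x ∈ Mhat p ∩ A} ≤ edist pstar p :=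
      Metric.infEDist_le_edist_of_mem hxp
    refine le_trans ?_ (h x hxU (ne_top_of_le_ne_top (edist_ne_top _ _) hle))
    rw [← EReal.coe_sub, ← EReal.coe_sub, EReal.coe_le_coe_iff]
    have hd : (Metric.infEDist pstar {p | x ∈ Mhat p ∩ A}).toReal ≤ dist p pstar := by
      rw [dist_comm, dist_edist]
      exact ENNReal.toReal_mono (edist_ne_top _ _) hle
    exact sub_le_sub_left (mul_le_mul_of_nonneg_left
      (hωmono.monotoneOn (mem_Ici.2 ENNReal.toReal_nonneg) (mem_Ici.2 dist_nonneg) hd) ha.le) c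
end

section
/- Let μ > λ ≥ 0 be such that F_λ and F_μ both attain a global minimum on A, and let x_λ be a global minimizer of F_λ on A and x_μ a global minimizer of F_μ on A. If F_λ(x_λ) = F_μ(x_μ), then for every ν > λ the set of global minimizers of F_ν on A coincides with the set of global minimizers of f on Ω. -/
open Filter Topology Set

lemma penaltyFun_of_eq_zero {X : Type*} {f : X → EReal} {φ : X → ℝ} {x : X} (h : φ x = 0)
    (lam : ℝ) : penaltyFun f φ lam x = f x := by
  simp [penaltyFun, h]

lemma penaltyFun_mono {X : Type*} (f : X → EReal) {φ : X → ℝ} {lam ν : ℝ} {x : X}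
    (hφ : 0 ≤ φ x) (h : lam ≤ ν) : penaltyFun f φ lam x ≤ penaltyFun f φ ν x :=
  add_le_add_right (EReal.coe_le_coe_iff.2 (mul_le_mul_of_nonneg_right h hφ)) (f x)

/-- Where `F_ν` is finite, it can fail to exceed `F_λ` for `λ < ν` only if `φ` vanishes. -/
lemma eq_zero_of_penaltyFun_le {X : Type*} {f : X → EReal} {φ : X → ℝ} {lam ν : ℝ} {x : X}
    (hφ : 0 ≤ φ x) (h : lam < ν) (hbot : f x ≠ ⊥) (htop : penaltyFun f φ ν x ≠ ⊤)
    (hle : penaltyFun f φ ν x ≤ penaltyFun f φ lam x) : φ x = 0 := by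
  have hftop : f x ≠ ⊤ := by
    intro hx
    exact htop (by rw [penaltyFun, hx, EReal.top_add_coe])
  simp only [penaltyFun] at hle
  lift f x to ℝ using ⟨hftop, hbot⟩ with r
  norm_cast at hle
  nlinarith

/-- If `f z` is a lower bound of `F_λ` on `A` for some `z ∈ A` with `φ z = 0`, then for `ν > λ`
the penalty function `F_ν` is exact on `A`. -/
lemma argmin_penaltyFun_eq_of_forall_le {X : Type*} {f : X → EReal} {φ : X → ℝ} {A : Set X}
    (hbot : ∀ x, f x ≠ ⊥) (hφ : ∀ x, 0 ≤ φ x) {z : X} (hzA : z ∈ A) (hz : φ z = 0)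
    (hztop : f z ≠ ⊤) {lam ν : ℝ} (hle : ∀ y ∈ A, f z ≤ penaltyFun f φ lam y) (h : lam < ν) :
    {x | x ∈ A ∧ ∀ y ∈ A, penaltyFun f φ ν x ≤ penaltyFun f φ ν y} =
      {x | x ∈ {x | φ x = 0} ∩ A ∧ ∀ y ∈ {x | φ x = 0} ∩ A, f x ≤ f y} := by
  ext x
  constructor
  · rintro ⟨hxA, hx⟩
    have hxz : penaltyFun f φ ν x ≤ f z := (hx z hzA).trans_eq (penaltyFun_of_eq_zero hz ν)
    have hx0 : φ x = 0 := eq_zero_of_penaltyFun_le (hφ x) h (hbot x)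
      (ne_top_of_le_ne_top hztop hxz) (hxz.trans (hle x hxA))
    refine ⟨⟨hx0, hxA⟩, fun y hy => ?_⟩
    simpa only [penaltyFun_of_eq_zero hx0, penaltyFun_of_eq_zero hy.1] using hx y hy.2
  · rintro ⟨⟨hx0, hxA⟩, hx⟩
    refine ⟨hxA, fun y hy => ?_⟩
    calc penaltyFun f φ ν x = f x := penaltyFun_of_eq_zero hx0 ν
      _ ≤ f z := hx z ⟨hz, hzA⟩
      _ ≤ penaltyFun f φ lam y := hle y hy
      _ ≤ penaltyFun f φ ν y := penaltyFun_mono f (hφ y) h.le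

/-- Theorem: if `x_λ`, `x_μ` are global minimizers on `A` of `F_λ`, `F_μ` with
`μ > λ ≥ 0` and `F_λ(x_λ) = F_μ(x_μ)`, then for every `ν > λ` the set of global
minimizers of `F_ν` on `A` coincides with the set of global minimizers of `f` on
`Ω = M ∩ A`. -/
theorem argmin_penalty_eq_argmin_of_equal_values {X : Type*} [TopologicalSpace X]
    (f : X → EReal) (φ : X → ℝ) (A M : Set X)
    (hAne : A.Nonempty) (hMne : M.Nonempty)
    (hfbot : ∀ x, f x ≠ ⊥) (hφnn : ∀ x, 0 ≤ φ x) (hMdef : M = {x | φ x = 0})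
    (hattain : ∃ z ∈ M ∩ A, (∀ y ∈ M ∩ A, f z ≤ f y) ∧ f z ≠ ⊤)
    (lam μ : ℝ) (hlam : 0 ≤ lam) (hlt : lam < μ)
    (xl : X) (hxlA : xl ∈ A) (hxl : ∀ y ∈ A, penaltyFun f φ lam xl ≤ penaltyFun f φ lam y)
    (xm : X) (hxmA : xm ∈ A) (hxm : ∀ y ∈ A, penaltyFun f φ μ xm ≤ penaltyFun f φ μ y)
    (heq : penaltyFun f φ lam xl = penaltyFun f φ μ xm) :
    ∀ ν : ℝ, lam < ν →
      {x | x ∈ A ∧ ∀ y ∈ A, penaltyFun f φ ν x ≤ penaltyFun f φ ν y} =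
        {x | x ∈ M ∩ A ∧ ∀ y ∈ M ∩ A, f x ≤ f y} := by
  subst hMdef
  obtain ⟨z, ⟨hz, hzA⟩, hzmin, hztop⟩ := hattain
  have hxmz : penaltyFun f φ μ xm ≤ f z := (hxm z hzA).trans_eq (penaltyFun_of_eq_zero hz μ)
  have hxm0 : φ xm = 0 := eq_zero_of_penaltyFun_le (hφnn xm) hlt (hfbot xm)
    (ne_top_of_le_ne_top hztop hxmz) (heq.symm.trans_le (hxl xm hxmA))
  refine fun ν hν => argmin_penaltyFun_eq_of_forall_le hfbot hφnn hzA hz hztop (fun y hy => ?_) hν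
  calc f z ≤ f xm := hzmin xm ⟨hxm0, hxmA⟩
    _ = penaltyFun f φ lam xl := by rw [heq, penaltyFun_of_eq_zero hxm0]
    _ ≤ penaltyFun f φ lam y := hxl y hy
end

section
/- Let X be a real normed vector space. Then the penalty function F_λ is (globally) exact if and only if the following two conditions hold: (1) F_λ is strongly non-degenerate; (2) for every R > 0 there exist λ* ≥ 0 and r > 0 such that (f* − f(y))/φ(y) ≤ λ* for every y ∈ (A ∩ B(0, R))∖Ω with d(y, Ω) < r. -/
open Filter Topology Set

/-- The penalty function `F_λ` is globally exact. -/
def GloballyExact {X : Type*} (f : X → EReal) (φ : X → ℝ) (A M : Set X) : Prop :=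
  ∃ lam0 : ℝ, 0 ≤ lam0 ∧ ∀ lam : ℝ, lam0 < lam →
    {x | x ∈ A ∧ ∀ y ∈ A, penaltyFun f φ lam x ≤ penaltyFun f φ lam y} =
      {x | x ∈ M ∩ A ∧ ∀ y ∈ M ∩ A, f x ≤ f y}

/-- The penalty function `F_λ` is strongly non-degenerate: there is a bounded selection
`x(·)` of global minimizers of `F_λ` on `A` for all large `λ` with
`liminf_{λ → ∞} d(x(λ), Ω) = 0`. -/
def StronglyNonDegenerate {X : Type*} [NormedAddCommGroup X] (f : X → EReal) (φ : X → ℝ)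
    (A M : Set X) : Prop :=
  ∃ lam0 : ℝ, 0 ≤ lam0 ∧ ∃ x : ℝ → X,
    (∀ lam : ℝ, lam0 ≤ lam →
      x lam ∈ A ∧ ∀ y ∈ A, penaltyFun f φ lam (x lam) ≤ penaltyFun f φ lam y) ∧
    Bornology.IsBounded (x '' Set.Ici lam0) ∧
    Filter.liminf (fun lam => Metric.infDist (x lam) (M ∩ A)) Filter.atTop = 0

theorem penaltyFun_eq_of_eq_zero {X : Type*} {f : X → EReal} {φ : X → ℝ} {x : X}
    (hx : φ x = 0) (lam : ℝ) : penaltyFun f φ lam x = f x := by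
  simp [penaltyFun, hx]

theorem penaltyFun_mono_s12 {X : Type*} {f : X → EReal} {φ : X → ℝ} {y : X} (hy : 0 ≤ φ y)
    {a b : ℝ} (hab : a ≤ b) : penaltyFun f φ a y ≤ penaltyFun f φ b y := by
  unfold penaltyFun
  gcongr

/-- At a point `y` with `φ y > 0`, the quotient `(c - f y) / φ y` is at most `b` iff
`c ≤ F_b y`. -/
theorem sub_div_le_iff_le_penaltyFun {X : Type*} {f : X → EReal} {φ : X → ℝ} {y : X} {c b : ℝ}
    (hbot : f y ≠ ⊥) (hy : 0 < φ y) :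
    ((c : EReal) - f y) / (φ y : EReal) ≤ (b : EReal) ↔ (c : EReal) ≤ penaltyFun f φ b y := by
  unfold penaltyFun
  induction h : f y with
  | bot => exact absurd h hbot
  | top =>
    rw [EReal.sub_top, EReal.bot_div_of_pos_ne_top (by exact_mod_cast hy) (EReal.coe_ne_top _),
      EReal.top_add_coe]
    simp
  | coe t =>
    rw [← EReal.coe_sub, ← EReal.coe_div]
    norm_cast
    rw [div_le_iff₀ hy, sub_le_iff_le_add']

/-- If `c` bounds `F_a` from below at `y` and `F_b y ≤ c` for some `b > a`, then `φ y = 0`. -/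
theorem eq_zero_of_penaltyFun_le_s12 {X : Type*} {f : X → EReal} {φ : X → ℝ} {y : X} {c a b : ℝ}
    (hbot : f y ≠ ⊥) (hy : 0 ≤ φ y) (hab : a < b) (hc : (c : EReal) ≤ penaltyFun f φ a y)
    (hle : penaltyFun f φ b y ≤ c) : φ y = 0 := by
  unfold penaltyFun at hc hle
  induction h : f y with
  | bot => exact absurd h hbot
  | top => rw [h, EReal.top_add_coe] at hle; exact absurd hle (by simp)
  | coe t =>
    rw [h] at hc hle
    norm_cast at hc hle
    nlinarith

/-- If `F_λ` is bounded below on `A` by the optimal value `c` for one parameter `λ ≥ 0`, then the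
penalty function is globally exact. -/
theorem globallyExact_of_le_penaltyFun {X : Type*} {f : X → EReal} {φ : X → ℝ} {A M : Set X}
    (hfbot : ∀ x, f x ≠ ⊥) (hφnn : ∀ x, 0 ≤ φ x) (hMdef : M = {x | φ x = 0}) {xstar : X}
    (hxstar : xstar ∈ M ∩ A) {c : ℝ} (hc : f xstar = c) {lam0 : ℝ} (hlam0 : 0 ≤ lam0)
    (h : ∀ y ∈ A, (c : EReal) ≤ penaltyFun f φ lam0 y) : GloballyExact f φ A M := by
  subst hMdef
  refine ⟨lam0, hlam0, fun lam hlam => Set.ext fun x => ⟨?_, ?_⟩⟩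
  · rintro ⟨hxA, hx⟩
    have hle := hx xstar hxstar.2
    rw [penaltyFun_eq_of_eq_zero hxstar.1, hc] at hle
    have hx0 := eq_zero_of_penaltyFun_le_s12 (hfbot x) (hφnn x) hlam (h x hxA) hle
    refine ⟨⟨hx0, hxA⟩, fun y hy => ?_⟩
    have hxy := hx y hy.2
    rwa [penaltyFun_eq_of_eq_zero hx0, penaltyFun_eq_of_eq_zero hy.1] at hxy
  · rintro ⟨⟨hx0, hxA⟩, hx⟩
    refine ⟨hxA, fun y hy => ?_⟩
    rw [penaltyFun_eq_of_eq_zero hx0]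
    exact ((hx xstar hxstar).trans_eq hc).trans ((h y hy).trans (penaltyFun_mono_s12 (hφnn y) hlam.le))

/-- Theorem: in a normed space, the penalty function `F_λ` is globally exact iff it is
strongly non-degenerate and for every `R > 0` the quotient `(f* - f(y))/φ(y)` is bounded
above on the part of `(A ∩ B(0, R)) \ Ω` lying sufficiently close to `Ω`. -/
theorem globallyExact_iff_stronglyNonDegenerate {X : Type*}
    [NormedAddCommGroup X] [NormedSpace ℝ X]
    (f : X → EReal) (φ : X → ℝ) (A M : Set X)
    (hAne : A.Nonempty) (hMne : M.Nonempty)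
    (hfbot : ∀ x, f x ≠ ⊥) (hφnn : ∀ x, 0 ≤ φ x) (hMdef : M = {x | φ x = 0})
    (xstar : X) (hxstar : xstar ∈ M ∩ A) (hmin : ∀ y ∈ M ∩ A, f xstar ≤ f y)
    (hfinite : f xstar ≠ ⊤) :
    GloballyExact f φ A M ↔
      (StronglyNonDegenerate f φ A M ∧
        ∀ R : ℝ, 0 < R → ∃ lams : ℝ, 0 ≤ lams ∧ ∃ r : ℝ, 0 < r ∧
          ∀ y ∈ (A ∩ Metric.closedBall 0 R) \ (M ∩ A),
            Metric.infDist y (M ∩ A) < r →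
              (f xstar - f y) / ((φ y : ℝ) : EReal) ≤ (lams : EReal)) := by
  lift f xstar to ℝ using ⟨hfinite, hfbot xstar⟩ with c hc
  constructor
  · rintro ⟨lam0, hlam0, h⟩
    have hopt : ∀ lam, lam0 < lam → ∀ y ∈ A, penaltyFun f φ lam xstar ≤ penaltyFun f φ lam y :=
      fun lam hlam => ((h lam hlam).ge ⟨hxstar, fun y hy => hc ▸ hmin y hy⟩).2
    refine ⟨⟨lam0 + 1, by linarith, fun _ => xstar,
      fun lam hlam => ⟨hxstar.2, hopt lam (by linarith)⟩,
      (Bornology.isBounded_singleton (x := xstar)).subset (by rintro _ ⟨_, _, rfl⟩; rfl), ?_⟩,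
      fun R _ => ⟨lam0 + 1, by linarith, 1, one_pos, ?_⟩⟩
    · simp [Metric.infDist_zero_of_mem hxstar]
    · rintro y ⟨⟨hyA, -⟩, hy⟩ -
      subst hMdef
      have hpos : 0 < φ y := (hφnn y).lt_of_ne' fun h0 => hy ⟨h0, hyA⟩
      rw [sub_div_le_iff_le_penaltyFun (hfbot y) hpos, hc,
        ← penaltyFun_eq_of_eq_zero (f := f) hxstar.1 (lam0 + 1)]
      exact hopt _ (by linarith) y hyA
  · rintro ⟨⟨lam0, hlam0, x, hx, hbdd, hlim⟩, h⟩
    obtain ⟨R, hR, hxR⟩ := hbdd.subset_closedBall_lt 0 0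
    have hxR' : ∀ lam, lam0 ≤ lam → x lam ∈ Metric.closedBall 0 R :=
      fun lam hlam => hxR (mem_image_of_mem x hlam)
    obtain ⟨lams, -, r, hr, hq⟩ := h R hR
    have hcob : IsCoboundedUnder (· ≥ ·) atTop
        (fun lam => Metric.infDist (x lam) (M ∩ A)) := by
      refine IsBoundedUnder.isCoboundedUnder_ge ⟨R + dist 0 xstar, ?_⟩
      rw [eventually_map]
      filter_upwards [eventually_ge_atTop lam0] with lam hlam
      exact (Metric.infDist_le_dist_of_mem hxstar).trans <|
        (dist_triangle _ 0 _).trans (by gcongr; exact hxR' lam hlam)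
    obtain ⟨lam, hlt, hlam⟩ := ((frequently_lt_of_liminf_lt hcob (hlim.trans_lt hr)).and_eventually
      (eventually_gt_atTop (max lams lam0))).exists
    obtain ⟨hlams, hlam'⟩ := max_lt_iff.1 hlam
    obtain ⟨hxA, hxmin⟩ := hx lam hlam'.le
    have hle := hxmin xstar hxstar.2
    subst hMdef
    rw [penaltyFun_eq_of_eq_zero hxstar.1, ← hc] at hle
    have hx0 : φ (x lam) = 0 := by
      by_contra hne
      have hpos : 0 < φ (x lam) := (hφnn _).lt_of_ne' hne
      have hquot := hq (x lam) ⟨⟨hxA, hxR' lam hlam'.le⟩, fun hmem => hne hmem.1⟩ hlt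
      rw [sub_div_le_iff_le_penaltyFun (hfbot _) hpos] at hquot
      exact hne (eq_zero_of_penaltyFun_le_s12 (hfbot _) hpos.le hlams hquot hle)
    refine globallyExact_of_le_penaltyFun hfbot hφnn rfl hxstar hc.symm
      (hlam0.trans hlam'.le) fun y hy => le_trans ?_ (hxmin y hy)
    rw [penaltyFun_eq_of_eq_zero hx0]
    exact hmin _ ⟨hx0, hxA⟩
end

section
/- Let (X, d) be a metric space, f be Lipschitz continuous on A∖Ω with Lipschitz constant L ≥ 0, and φ be lower semicontinuous on A. Suppose there exists a > 0 such that φ^↓_A(x) ≤ −a for every x ∈ A∖Ω. If x ∈ A is an inf-stationary point of F_λ (i.e. F_λ^↓(x) ≥ 0) and λ > L/a, then x ∈ Ω. In other words, for every λ > L/a there are no inf-stationary points of F_λ in A outside Ω. -/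
open Filter Topology Set

/-- The rate of steepest descent `g^↓(x) = liminf_{y → x, y ≠ x} (g(y) - g(x))/d(y, x)`
of a real-valued function. -/
noncomputable def steepestDescentRate {X : Type*} [MetricSpace X] (g : X → ℝ)
    (x : X) : EReal :=
  Filter.liminf (fun y => (((g y - g x) / dist y x : ℝ) : EReal)) (𝓝[≠] x)

/-- The rate of steepest descent `g^↓_A(x)` of a real-valued function `g` on the set `A`
at the point `x`. -/
noncomputable def steepestDescentRateOn {X : Type*} [MetricSpace X] (g : X → ℝ)
    (A : Set X) (x : X) : EReal :=
  Filter.liminf (fun y => (((g y - g x) / dist y x : ℝ) : EReal)) (𝓝[A \ {x}] x)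

/-- Theorem: if `f` is Lipschitz continuous on `A \ Ω` with constant `L`, `φ` is l.s.c.
on `A` and `φ^↓_A(x) ≤ -a < 0` for all `x ∈ A \ Ω`, then for every `λ > L/a` the penalty
function `F_λ` has no inf-stationary points (`F_λ^↓(x) ≥ 0`) in `A` outside `Ω`. -/
theorem no_infStationary_points_outside_feasible_set {X : Type*} [MetricSpace X]
    (f : X → ℝ) (φ : X → ℝ) (A M : Set X)
    (hAne : A.Nonempty) (hMne : M.Nonempty)
    (hφnn : ∀ x, 0 ≤ φ x) (hMdef : M = {x | φ x = 0})
    (L : ℝ) (hL : 0 ≤ L)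
    (hLip : ∀ x ∈ A \ (M ∩ A), ∀ y ∈ A \ (M ∩ A), |f x - f y| ≤ L * dist x y)
    (hφlsc : LowerSemicontinuousOn (fun x => (φ x : ℝ)) A)
    (a : ℝ) (ha : 0 < a)
    (hdesc : ∀ x ∈ A \ (M ∩ A), steepestDescentRateOn φ A x ≤ ((-a : ℝ) : EReal)) :
    ∀ lam : ℝ, L / a < lam → ∀ x ∈ A,
      (0 : EReal) ≤ steepestDescentRate (fun y => f y + lam * φ y) x → x ∈ M ∩ A := by
  intro lam hlam x hxA hstat
  by_contra hx
  have hlam0 : 0 < lam := (div_nonneg hL ha.le).trans_lt hlam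
  have hLa : L / lam < a := by
    rw [div_lt_iff₀ ha] at hlam
    rw [div_lt_iff₀ hlam0]
    linarith
  obtain ⟨b, hLb, hba⟩ := exists_between hLa
  have hneg : L - lam * b < 0 := by
    rw [div_lt_iff₀ hlam0] at hLb
    linarith
  have hφx : 0 < φ x := by
    refine (hφnn x).lt_of_ne fun h => hx ⟨?_, hxA⟩
    rw [hMdef]
    exact h.symm
  have hφdec : ∃ᶠ y in 𝓝[A \ {x}] x, (((φ y - φ x) / dist y x : ℝ) : EReal) < ((-b : ℝ) : EReal) :=
    frequently_lt_of_liminf_lt (h := (hdesc x ⟨hxA, hx⟩).trans_lt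
      (EReal.coe_lt_coe_iff.2 (neg_lt_neg hba)))
  have hφpos : ∀ᶠ y in 𝓝[A \ {x}] x, 0 < φ y :=
    (hφlsc x hxA 0 hφx).filter_mono (nhdsWithin_mono x sdiff_subset)
  have hFrate : ∀ᶠ y in 𝓝[A \ {x}] x, ((L - lam * b : ℝ) : EReal) <
      (((f y + lam * φ y - (f x + lam * φ x)) / dist y x : ℝ) : EReal) :=
    (eventually_lt_of_lt_liminf ((EReal.coe_lt_coe_iff.2 hneg).trans_le hstat)).filter_mono
      (nhdsWithin_mono x fun _ hy => hy.2)
  obtain ⟨y, hdec, hpos, hrate, hyA, hyx⟩ :=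
    (hφdec.and_eventually (hφpos.and (hFrate.and self_mem_nhdsWithin))).exists
  have hd : 0 < dist y x := dist_pos.2 hyx
  have hyM : y ∉ M ∩ A := fun h => by
    have hy0 := h.1
    rw [hMdef] at hy0
    exact hpos.ne' hy0
  have hlip := (le_abs_self _).trans (hLip y ⟨hyA, hyM⟩ x ⟨hxA, hx⟩)
  rw [EReal.coe_lt_coe_iff, div_lt_iff₀ hd] at hdec
  rw [EReal.coe_lt_coe_iff, lt_div_iff₀ hd] at hrate
  have := mul_lt_mul_of_pos_left hdec hlam0
  linarith
end
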